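/- Let 0 < σ < 1 and let ν be real such that (k − ν − 1/2)/σ is not an integer for any natural number k. Then for every natural number M there exist constants C > 0 and T > 0 such that for all real t ≥ T: | (i t/2)^{−ν−1} L_ν(i t; −σ) − (1/π) Σ_{k=0}^{M−1} Γ(k + 1/2) · (t/2)^{−2k−2} / Γ(ν + 3/2 + σ(k+1)) | ≤ C · t^{−2M−2}, where (i t/2)^{−ν−1} is the principal power. That is, on the imaginary axis L_ν(·;−σ) has the complete algebraic asymptotic expansion (i t/2)^{−ν−1} L_ν(i t;−σ) ∼ (1/π) Σ_{k≥0} Γ(k+1/2)(t/2)^{−2k−2}/Γ(ν+3/2+σ(k+1)) as t → +∞. -/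

import Mathlib

open Filter Topology

/-- The generalised Struve function
`L_ν(z;a) = (z/2)^{ν+1} Σ_{n≥0} (z/2)^{2n} / (Γ(n+3/2) Γ(an+ν+3/2))`,
with principal branch power and the entire reciprocal Gamma function
(`Complex.Gamma` vanishes at the poles, so division realises `1/Γ`). -/
noncomputable def struveL (ν a : ℝ) (z : ℂ) : ℂ :=
  (z / 2) ^ ((ν : ℂ) + 1) *
    ∑' n : ℕ, (z / 2) ^ (2 * n) /
      (Complex.Gamma ((n : ℂ) + 3 / 2) *
        Complex.Gamma ((a : ℂ) * (n : ℂ) + (ν : ℂ) + 3 / 2))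

namespace StruveAux
open MeasureTheory Set

lemma cint_integrable {q s : ℝ} (hq : -1 < q) (hs : 0 < s) {p : ℂ} (hp : 0 < p.re) :
    IntegrableOn (fun r : ℝ => ((r ^ q : ℝ) : ℂ) * Complex.exp (-p * ((r ^ s : ℝ) : ℂ))) (Ioi 0) := by
  have h := integrableOn_rpow_mul_exp_neg_mul_rpow hq hs hp
  refine Integrable.mono' h ?_ ?_
  · apply Measurable.aestronglyMeasurable
    fun_prop
  · filter_upwards [ae_restrict_mem measurableSet_Ioi] with r hr
    have hr' : (0:ℝ) < r := hr
    rw [norm_mul, Complex.norm_exp, Complex.norm_real, Real.norm_of_nonneg (by positivity)]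
    apply le_of_eq
    congr 2
    simp [Complex.mul_re]

lemma cint_deriv {q s : ℝ} (hq : -1 < q) (hs : 0 < s) {p : ℂ} (hp : 0 < p.re) :
    DifferentiableAt ℂ (fun p : ℂ => ∫ r in Ioi (0:ℝ), ((r ^ q : ℝ) : ℂ) * Complex.exp (-p * ((r ^ s : ℝ) : ℂ))) p := by
  have hU : {z : ℂ | p.re / 2 < z.re} ∈ 𝓝 p :=
    (isOpen_lt continuous_const Complex.continuous_re).mem_nhds (by simp; linarith)
  have hb := integrableOn_rpow_mul_exp_neg_mul_rpow (show -1 < q + s by linarith) hs (half_pos hp)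
  have := hasDerivAt_integral_of_dominated_loc_of_deriv_le (μ := volume.restrict (Ioi (0:ℝ)))
    (F := fun (p : ℂ) (r : ℝ) => ((r ^ q : ℝ) : ℂ) * Complex.exp (-p * ((r ^ s : ℝ) : ℂ)))
    (F' := fun (p : ℂ) (r : ℝ) => ((r ^ q : ℝ) : ℂ) * (Complex.exp (-p * ((r ^ s : ℝ) : ℂ)) * (-1 * ((r ^ s : ℝ) : ℂ)))) 
    (bound := fun r => r ^ (q + s) * Real.exp (-(p.re/2) * r ^ s)) hU ?_ (cint_integrable hq hs hp) ?_ ?_ hb ?_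
  · exact this.2.differentiableAt
  · refine Eventually.of_forall fun z => ?_
    apply Measurable.aestronglyMeasurable
    fun_prop
  · apply Measurable.aestronglyMeasurable
    fun_prop
  · filter_upwards [ae_restrict_mem measurableSet_Ioi] with r hr z hz
    have hr' : (0:ℝ) < r := hr
    have hz' : p.re / 2 < z.re := hz
    rw [norm_mul, norm_mul, Complex.norm_exp, Complex.norm_real, Real.norm_of_nonneg (by positivity), norm_mul,
      Complex.norm_real, Real.norm_of_nonneg (by positivity), Real.rpow_add hr']
    have : (-z * ((r ^ s : ℝ) : ℂ)).re = - z.re * r ^ s := by simp [Complex.mul_re]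
    rw [this]
    have h1 : Real.exp (-z.re * r ^ s) ≤ Real.exp (-(p.re/2) * r ^ s) := by
      apply Real.exp_le_exp.2
      have : 0 < r ^ s := by positivity
      nlinarith
    have h2 : 0 < r ^ s := by positivity
    have h3 : 0 < r ^ q := by positivity
    simp only [norm_neg, norm_one, one_mul]
    calc _ = r ^ q * r ^ s * Real.exp (-z.re * r ^ s) := by ring
      _ ≤ _ := by gcongr
  · filter_upwards with r z _
    have h : HasDerivAt (fun z : ℂ => -z * ((r ^ s : ℝ) : ℂ)) (-1 * ((r ^ s : ℝ) : ℂ)) z :=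
      (hasDerivAt_id z).neg.mul_const _
    exact (h.cexp).const_mul _

lemma cint_eq {q s : ℝ} (hq : -1 < q) (hs : 0 < s) {p : ℂ} (hp : 0 < p.re) :
    ∫ r in Ioi (0:ℝ), ((r ^ q : ℝ) : ℂ) * Complex.exp (-p * ((r ^ s : ℝ) : ℂ)) =
      p ^ ((-(q + 1) / s : ℝ) : ℂ) * ((1 / s * Real.Gamma ((q + 1) / s) : ℝ) : ℂ) := by
  have hO : IsOpen {z : ℂ | 0 < z.re} := isOpen_lt continuous_const Complex.continuous_re
  have hf : AnalyticOnNhd ℂ (fun p : ℂ => ∫ r in Ioi (0:ℝ), ((r ^ q : ℝ) : ℂ) * Complex.exp (-p * ((r ^ s : ℝ) : ℂ))) {z : ℂ | 0 < z.re} :=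
    DifferentiableOn.analyticOnNhd (fun z hz => (cint_deriv hq hs hz).differentiableWithinAt) hO
  have hg : AnalyticOnNhd ℂ (fun p : ℂ => p ^ ((-(q + 1) / s : ℝ) : ℂ) * ((1 / s * Real.Gamma ((q + 1) / s) : ℝ) : ℂ)) {z : ℂ | 0 < z.re} := by
    apply DifferentiableOn.analyticOnNhd _ hO
    intro z hz
    apply DifferentiableAt.differentiableWithinAt
    exact (differentiableAt_id.cpow_const (Or.inl hz)).mul_const _
  have hpc : IsPreconnected {z : ℂ | 0 < z.re} := (convex_halfSpace_re_gt 0).isPreconnected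
  have h1 : (1:ℂ) ∈ {z : ℂ | 0 < z.re} := by simp
  refine hf.eqOn_of_preconnected_of_frequently_eq hg hpc h1 ?_ hp
  have key : ∀ x : ℝ, 0 < x → (∫ r in Ioi (0:ℝ), ((r ^ q : ℝ) : ℂ) * Complex.exp (-(x:ℂ) * ((r ^ s : ℝ) : ℂ))) =
      (x:ℂ) ^ ((-(q + 1) / s : ℝ) : ℂ) * ((1 / s * Real.Gamma ((q + 1) / s) : ℝ) : ℂ) := by
    intro x hx
    rw [← Complex.ofReal_cpow hx.le, ← Complex.ofReal_mul, ← mul_assoc, ← integral_rpow_mul_exp_neg_mul_rpow hs hq hx,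
      ← integral_complex_ofReal]
    push_cast
    rfl
  have ht : Tendsto (fun x : ℝ => (x : ℂ)) (𝓝[≠] 1) (𝓝[≠] 1) := by
    apply tendsto_nhdsWithin_of_tendsto_nhds_of_eventually_within
    · exact (Complex.continuous_ofReal.tendsto' (1:ℝ) (1:ℂ) (by simp)).mono_left nhdsWithin_le_nhds
    · filter_upwards [self_mem_nhdsWithin] with x hx
      simpa using hx
  apply ht.frequently
  apply Eventually.frequently
  have : ∀ᶠ x : ℝ in 𝓝[≠] 1, 0 < x := nhdsWithin_le_nhds (lt_mem_nhds one_pos)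
  filter_upwards [this] with x hx using key x hx

noncomputable def rg (x : ℝ) : ℝ := (Real.Gamma x)⁻¹

lemma rg_rec (s : ℝ) : rg s = s * rg (s + 1) := by
  unfold rg
  rcases ne_or_eq s 0 with (h | rfl)
  · rw [Real.Gamma_add_one h, mul_inv, mul_inv_cancel_left₀ h]
  · rw [zero_add, Real.Gamma_zero, inv_zero, zero_mul]

/-- reflection formula, for `0 < a` -/
lemma rg_refl {a : ℝ} (ha : 0 < a) : rg (1 - a) = Real.Gamma a * Real.sin (Real.pi * a) / Real.pi := by
  have h := Real.Gamma_mul_Gamma_one_sub a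
  have hG := (Real.Gamma_pos_of_pos ha).ne'
  unfold rg
  have h2 : Real.Gamma (1 - a) = Real.pi / Real.sin (Real.pi * a) / Real.Gamma a := by
    rw [← h]; field_simp
  rw [h2, inv_div, div_div_eq_mul_div]

lemma Gamma_add_le {σ y : ℝ} (h0 : 0 < σ) (h1 : σ < 1) (hy : 0 < y) :
    Real.Gamma (y + σ) ≤ y ^ σ * Real.Gamma y := by
  have h := Real.Gamma_mul_add_mul_le_rpow_Gamma_mul_rpow_Gamma hy (show 0 < y + 1 by linarith)
    (show 0 < 1 - σ by linarith) h0 (by ring)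
  have hG := Real.Gamma_pos_of_pos hy
  rw [Real.Gamma_add_one hy.ne', Real.mul_rpow hy.le hG.le] at h
  calc Real.Gamma (y + σ) = Real.Gamma ((1 - σ) * y + σ * (y + 1)) := by congr 1; ring
    _ ≤ _ := h
    _ = y ^ σ * (Real.Gamma y ^ (1 - σ) * Real.Gamma y ^ σ) := by ring
    _ = _ := by rw [← Real.rpow_add hG]; simp

lemma summ_major {σ : ℝ} (h0 : 0 < σ) (h1 : σ < 1) (a α y : ℝ) :
    Summable fun n : ℕ => y ^ n * Real.Gamma (a + σ * n) * rg (n + α) := by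
  set K := |a| + |α| with hK
  have hz : Tendsto (fun n : ℕ => (n : ℝ) + α + K) atTop atTop :=
    tendsto_atTop_add_const_right _ _ (tendsto_atTop_add_const_right _ _ tendsto_natCast_atTop_atTop)
  have hs : Tendsto (fun n : ℕ => σ * (n : ℝ)) atTop atTop :=
    tendsto_natCast_atTop_atTop.const_mul_atTop h0
  have hr := (tendsto_rpow_neg_atTop (show 0 < 1 - σ by linarith)).comp hz
  have hε : 0 < 1 / (4 * (|y| + 1)) := by positivity
  have e1 := hr.eventually (gt_mem_nhds hε)
  refine summable_of_ratio_norm_eventually_le (r := 1 / 2) (by norm_num) ?_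
  filter_upwards [e1, hz.eventually_gt_atTop (2 * K + 1), hs.eventually_gt_atTop (-a)] with n hn1 hn2 hn3
  set z := (n : ℝ) + α + K with hzd
  have hKn : 0 ≤ K := by positivity
  have hz0 : 0 < z := by linarith
  have ha0 : 0 < a + σ * n := by linarith
  have hα0 : 0 < (n : ℝ) + α := by linarith
  have haz : a + σ * n ≤ z := by
    have : σ * n ≤ n := by
      have : (0:ℝ) ≤ n := by positivity
      nlinarith
    have := le_abs_self a
    have := neg_abs_le α
    rw [hzd, hK]; linarith
  have hzs : |y| * z ^ σ ≤ 1 / 2 * (n + α) := by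
    have h2 : z ^ σ = z ^ (-(1 - σ)) * z := by
      rw [← Real.rpow_add_one hz0.ne']; congr 1; ring
    have hn1' : z ^ (-(1 - σ)) < 1 / (4 * (|y| + 1)) := hn1
    have h3 : |y| * z ^ (-(1-σ)) ≤ 1 / 4 := by
      have h4 : |y| * z ^ (-(1-σ)) ≤ |y| * (1 / (4 * (|y| + 1))) := by gcongr
      have h5 : |y| * (1 / (4 * (|y| + 1))) ≤ 1 / 4 := by
        rw [mul_one_div, div_le_div_iff₀ (by positivity) (by norm_num)]
        linarith
      linarith
    have h6 : |y| * z ^ σ ≤ 1 / 4 * z := by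
      rw [h2, ← mul_assoc]; gcongr
    linarith
  have hG := Gamma_add_le h0 h1 ha0
  have hrg : rg (n + α) = (n + α) * rg (n + α + 1) := rg_rec _
  have hG1 := Real.Gamma_pos_of_pos ha0
  have hG2 := Real.Gamma_pos_of_pos (show 0 < a + σ * n + σ by linarith)
  have hrp : 0 < rg (n + α + 1) := inv_pos.2 (Real.Gamma_pos_of_pos (by linarith))
  have e3 : a + σ * ((n + 1 : ℕ) : ℝ) = a + σ * n + σ := by push_cast; ring
  have e4 : ((n + 1 : ℕ) : ℝ) + α = n + α + 1 := by push_cast; ring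
  rw [e3, e4, hrg]
  simp only [norm_mul, norm_pow, Real.norm_eq_abs]
  rw [abs_of_pos hG1, abs_of_pos hG2, abs_of_pos hrp, abs_of_pos hα0]
  have hzz : (a + σ * n) ^ σ ≤ z ^ σ := by gcongr
  calc |y| ^ (n + 1) * Real.Gamma (a + σ * n + σ) * rg (n + α + 1)
      ≤ |y| ^ (n + 1) * (z ^ σ * Real.Gamma (a + σ * n)) * rg (n + α + 1) := by
        gcongr
        exact hG.trans (by gcongr)
    _ = |y| ^ n * (|y| * z ^ σ) * Real.Gamma (a + σ * n) * rg (n + α + 1) := by ring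
    _ ≤ |y| ^ n * (1 / 2 * (n + α)) * Real.Gamma (a + σ * n) * rg (n + α + 1) := by gcongr
    _ = _ := by ring

noncomputable def term (σ α β x : ℝ) (n : ℕ) : ℝ := (-x) ^ n * rg (n + α) * rg (β - σ * n)

lemma summ_term {σ : ℝ} (h0 : 0 < σ) (h1 : σ < 1) (α β x : ℝ) : Summable (term σ α β x) := by
  have h := (summ_major h0 h1 (1 - β) α (-x)).norm
  have hs : Tendsto (fun n : ℕ => σ * (n : ℝ)) atTop atTop :=
    tendsto_natCast_atTop_atTop.const_mul_atTop h0
  refine Summable.of_norm_bounded_eventually_nat h ?_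
  filter_upwards [hs.eventually_gt_atTop (β - 1)] with n hn
  have ha : 0 < 1 - β + σ * n := by linarith
  have h3 := rg_refl ha
  rw [show 1 - (1 - β + σ * n) = β - σ * n by ring] at h3
  have h4 : ‖rg (β - σ * n)‖ ≤ ‖Real.Gamma (1 - β + σ * n)‖ := by
    rw [h3, mul_div_assoc, norm_mul]
    have : ‖Real.sin (Real.pi * (1 - β + σ * n)) / Real.pi‖ ≤ 1 := by
      rw [norm_div, Real.norm_eq_abs, Real.norm_eq_abs, abs_of_pos Real.pi_pos, div_le_one Real.pi_pos]
      have := Real.abs_sin_le_one (Real.pi * (1 - β + σ * n))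
      linarith [Real.pi_gt_three]
    exact mul_le_of_le_one_right (norm_nonneg _) this
  unfold term
  rw [norm_mul, norm_mul, norm_mul, norm_mul]
  calc _ ≤ ‖(-x) ^ n‖ * ‖rg (n + α)‖ * ‖Real.Gamma (1 - β + σ * n)‖ := by gcongr
    _ = _ := by ring

noncomputable def F (σ α β x : ℝ) : ℝ := ∑' n, term σ α β x n

lemma F_shift {σ : ℝ} (h0 : 0 < σ) (h1 : σ < 1) (α β x : ℝ) :
    F σ α β x = rg α * rg β - x * F σ (α + 1) (β - σ) x := by
  unfold F
  rw [(summ_term h0 h1 α β x).tsum_eq_zero_add, ← tsum_mul_left, sub_eq_add_neg, ← tsum_neg]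
  congr 1
  · simp [term]
  · congr 1; ext n
    unfold term
    rw [show ((n + 1 : ℕ) : ℝ) + α = n + (α + 1) by push_cast; ring,
      show β - σ * ((n + 1 : ℕ) : ℝ) = β - σ - σ * n by push_cast; ring]
    ring

lemma F_rel {σ : ℝ} (h0 : 0 < σ) (h1 : σ < 1) (α β x : ℝ) :
    σ * F σ (α - 1) β x = (σ * (α - 1) + (β - 1)) * F σ α β x - F σ α (β - 1) x := by
  unfold F
  rw [← tsum_mul_left, ← tsum_mul_left, ← ((summ_term h0 h1 α β x).mul_left _).tsum_sub (summ_term h0 h1 α (β - 1) x)]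
  congr 1; ext n
  unfold term
  have e1 := rg_rec (n + (α - 1))
  have e2 := rg_rec (β - 1 - σ * n)
  rw [show (n : ℝ) + (α - 1) + 1 = n + α by ring] at e1
  rw [show β - 1 - σ * (n : ℝ) + 1 = β - σ * n by ring] at e2
  rw [e1, e2]
  ring

lemma F_one_rel {σ : ℝ} (h0 : 0 < σ) (h1 : σ < 1) (β x : ℝ) :
    (β - 1) * F σ 1 β x = F σ 1 (β - 1) x - σ * (x * F σ 1 (β - σ) x) := by
  have a := F_rel h0 h1 1 β x
  have b := F_shift h0 h1 0 β x
  simp only [sub_self, zero_add, mul_zero] at a b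
  rw [b] at a
  have : rg 0 = 0 := by simp [rg]
  rw [this] at a
  linarith

/-- decay faster than any power -/
def Decay (σ β : ℝ) : Prop := ∀ N : ℕ, ∃ C : ℝ, ∀ v : ℝ, 0 ≤ v → v ^ N * |F σ 1 β v| ≤ C

lemma decay_step {σ : ℝ} (h0 : 0 < σ) (h1 : σ < 1) {β : ℝ} (hβ : β ≠ 1)
    (ha : Decay σ (β - 1)) (hb : Decay σ (β - σ)) : Decay σ β := by
  intro N
  obtain ⟨C1, hC1⟩ := ha N
  obtain ⟨C2, hC2⟩ := hb (N + 1)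
  refine ⟨(C1 + σ * C2) / |β - 1|, fun v hv => ?_⟩
  have hβ' : 0 < |β - 1| := abs_pos.2 (sub_ne_zero.2 hβ)
  rw [le_div_iff₀ hβ']
  have h := F_one_rel h0 h1 β v
  have h2 : |β - 1| * |F σ 1 β v| ≤ |F σ 1 (β - 1) v| + σ * (v * |F σ 1 (β - σ) v|) := by
    rw [← abs_mul, h]
    refine (abs_sub _ _).trans ?_
    rw [abs_mul, abs_mul, abs_of_pos h0, abs_of_nonneg hv]
  have hvN : 0 ≤ v ^ N := by positivity
  calc v ^ N * |F σ 1 β v| * |β - 1| = v ^ N * (|β - 1| * |F σ 1 β v|) := by ring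
    _ ≤ v ^ N * (|F σ 1 (β - 1) v| + σ * (v * |F σ 1 (β - σ) v|)) := by gcongr
    _ = v ^ N * |F σ 1 (β - 1) v| + σ * (v ^ (N + 1) * |F σ 1 (β - σ) v|) := by ring
    _ ≤ _ := by gcongr; exact hC1 v hv; exact hC2 v hv

/-- good parameters: never hit a positive integer -/
def Good (σ β : ℝ) : Prop := ∀ (k : ℕ) (m : ℤ), β + m * σ ≠ k + 1

lemma Good.sub_one {σ β : ℝ} (h : Good σ β) : Good σ (β - 1) := by
  intro k m e
  apply h (k + 1) m
  push_cast; linarith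

lemma Good.shift {σ β : ℝ} (h : Good σ β) (j : ℤ) : Good σ (β + j * σ) := by
  intro k m e
  apply h k (m + j)
  push_cast; linarith

lemma decay_all {σ : ℝ} (h0 : 0 < σ) (h1 : σ < 1) (base : ∀ β, β < 1 → Decay σ β) (β : ℝ) (hg : Good σ β) :
    Decay σ β := by
  have key : ∀ m : ℕ, ∀ β, Good σ β → β < 1 + m * σ → Decay σ β := by
    intro m
    induction m with
    | zero => intro β _ h; exact base β (by simpa using h)
    | succ m ih =>
      intro β hg h
      push_cast at h
      have hne : β ≠ 1 := by
        have := hg 0 0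
        simpa using this
      refine decay_step h0 h1 hne (ih _ hg.sub_one (by linarith)) (ih _ ?_ (by linarith))
      have := hg.shift (-1)
      rwa [show β + ((-1 : ℤ) : ℝ) * σ = β - σ by push_cast; ring] at this
  obtain ⟨m, hm⟩ := exists_nat_gt ((β - 1) / σ)
  rw [div_lt_iff₀ h0] at hm
  exact key m β hg (by linarith)


lemma expI_cpow {φ : ℝ} (h1 : -Real.pi < φ) (h2 : φ ≤ Real.pi) (x : ℝ) :
    Complex.exp (φ * Complex.I) ^ (x : ℂ) = Complex.exp ((φ * x : ℝ) * Complex.I) := by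
  rw [Complex.cpow_def_of_ne_zero (Complex.exp_ne_zero _), Complex.log_exp (by simpa using h1) (by simpa using h2)]
  congr 1
  push_cast; ring

lemma mul_cpow_left {v : ℝ} (hv : 0 < v) {z : ℂ} (hz : z ≠ 0) (x : ℂ) :
    ((v : ℂ) * z) ^ x = (v : ℂ) ^ x * z ^ x := by
  have hv' : (v : ℂ) ≠ 0 := by exact_mod_cast hv.ne'
  rw [Complex.cpow_def_of_ne_zero (mul_ne_zero hv' hz), Complex.cpow_def_of_ne_zero hv', Complex.cpow_def_of_ne_zero hz,
    Complex.log_ofReal_mul hv hz, Complex.ofReal_log hv.le, add_mul, Complex.exp_add]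

lemma hankel {θ a : ℝ} (hθ0 : 0 < θ) (hθ1 : θ < Real.pi) (hc : Real.cos θ < 0) (ha : 0 < a) :
    (Complex.exp ((θ * a : ℝ) * Complex.I) *
      ∫ r in Ioi (0:ℝ), ((r ^ (a - 1) : ℝ) : ℂ) * Complex.exp (-(-Complex.exp (θ * Complex.I)) * ((r ^ (1:ℝ) : ℝ) : ℂ))).im
      = Real.pi * rg (1 - a) := by
  have hp : -Complex.exp (θ * Complex.I) = Complex.exp ((θ - Real.pi : ℝ) * Complex.I) := by
    push_cast
    rw [sub_mul, Complex.exp_sub, Complex.exp_pi_mul_I, div_neg, div_one]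
  have hre : 0 < (-Complex.exp (θ * Complex.I)).re := by
    rw [Complex.neg_re, Complex.exp_ofReal_mul_I_re]; linarith
  rw [cint_eq (by linarith) one_pos hre, hp, expI_cpow (by linarith) (by linarith), ← mul_assoc, ← Complex.exp_add]
  have : ((θ * a : ℝ) : ℂ) * Complex.I + (((θ - Real.pi) * (-(a - 1 + 1) / 1) : ℝ) : ℂ) * Complex.I
      = ((Real.pi * a : ℝ) : ℂ) * Complex.I := by push_cast; ring
  rw [this, Complex.im_mul_ofReal, Complex.exp_ofReal_mul_I_im, rg_refl ha]
  simp
  field_simp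

noncomputable def hI (σ β θ v r : ℝ) : ℂ :=
  Complex.exp ((θ * (1 - β) : ℝ) * Complex.I) * ((r ^ (-β) : ℝ) : ℂ) *
    Complex.exp (Complex.exp (θ * Complex.I) * r) *
      Complex.exp (-(v * Complex.exp ((θ * σ : ℝ) * Complex.I)) * ((r ^ σ : ℝ) : ℂ))

lemma F_rep {σ : ℝ} (h0 : 0 < σ) (h1 : σ < 1) {β θ : ℝ} (hβ : β < 1) (hθ0 : 0 < θ) (hθ1 : θ < Real.pi)
    (hc : Real.cos θ < 0) (v : ℝ) :
    Real.pi * F σ 1 β v = (∫ r in Ioi (0:ℝ), hI σ β θ v r).im := by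
  set Fn : ℕ → ℝ → ℂ := fun n r => (((-v) ^ n * rg (n + 1) : ℝ) : ℂ) * (Complex.exp ((θ * (1 - β + σ * n) : ℝ) * Complex.I) *
    (((r ^ ((1 - β + σ * n) - 1) : ℝ) : ℂ) * Complex.exp (-(-Complex.exp (θ * Complex.I)) * ((r ^ (1:ℝ) : ℝ) : ℂ)))) with hFn
  have hre : 0 < (-Complex.exp (θ * Complex.I)).re := by
    rw [Complex.neg_re, Complex.exp_ofReal_mul_I_re]; linarith
  have ha : ∀ n : ℕ, 0 < 1 - β + σ * n := fun n => by
    have : 0 ≤ σ * n := by positivity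
    linarith
  have hInteg : ∀ n, Integrable (Fn n) (volume.restrict (Ioi 0)) := fun n =>
    ((cint_integrable (by linarith [ha n]) one_pos hre).const_mul _).const_mul _
  have hnorm : ∀ n, ∫ r in Ioi (0:ℝ), ‖Fn n r‖ =
      (-Real.cos θ) ^ (-(1 - β)) * ‖(v * (-Real.cos θ) ^ (-σ)) ^ n * Real.Gamma (1 - β + σ * n) * rg (n + 1)‖ := by
    intro n
    have e : ∀ r ∈ Ioi (0:ℝ), ‖Fn n r‖ = |v| ^ n * |rg (n + 1)| * (r ^ ((1 - β + σ * n) - 1) * Real.exp (-(-Real.cos θ) * r ^ (1:ℝ))) := by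
      intro r hr
      have hr' : (0:ℝ) < r := hr
      simp only [hFn, norm_mul, Complex.norm_exp_ofReal_mul_I, Complex.norm_real, Complex.norm_exp, one_mul]
      rw [Real.norm_of_nonneg (show 0 ≤ r ^ ((1 - β + σ * n) - 1) by positivity)]
      have : (-(-Complex.exp (θ * Complex.I)) * ((r ^ (1:ℝ) : ℝ) : ℂ)).re = -(-Real.cos θ) * r ^ (1:ℝ) := by
        rw [Complex.re_mul_ofReal, neg_neg, Complex.exp_ofReal_mul_I_re, neg_neg]
      rw [this]
      simp
    rw [setIntegral_congr_fun measurableSet_Ioi e, integral_const_mul,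
      integral_rpow_mul_exp_neg_mul_rpow one_pos (by linarith [ha n]) (by linarith : 0 < -Real.cos θ)]
    have hcp : 0 < -Real.cos θ := by linarith
    have e2 : (-Real.cos θ) ^ (-((1 - β + σ * n) - 1 + 1) / 1) = (-Real.cos θ) ^ (-(1 - β)) * ((-Real.cos θ) ^ (-σ)) ^ n := by
      rw [← Real.rpow_mul_natCast hcp.le, ← Real.rpow_add hcp]
      congr 1; ring
    rw [e2]
    have hG := Real.Gamma_pos_of_pos (ha n)
    simp only [sub_add_cancel, div_one, norm_mul, norm_pow, Real.norm_eq_abs, abs_of_pos hG, mul_one, mul_pow]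
    rw [abs_of_pos (show 0 < (-Real.cos θ) ^ (-σ) by positivity)]
    ring
  have hsum : Summable fun n => ∫ r in Ioi (0:ℝ), ‖Fn n r‖ := by
    simp_rw [hnorm]
    exact ((summ_major h0 h1 (1 - β) 1 _).norm).mul_left _
  have hS := hasSum_integral_of_summable_integral_norm hInteg hsum
  have hS2 := Complex.hasSum_im hS
  have hts : ∫ r in Ioi (0:ℝ), ∑' n, Fn n r = ∫ r in Ioi (0:ℝ), hI σ β θ v r := by
    refine setIntegral_congr_fun measurableSet_Ioi fun r hr => ?_
    have hr' : (0:ℝ) < r := hr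
    unfold hI
    have hexp : ∀ z : ℂ, Complex.exp z = ∑' n : ℕ, z ^ n / n.factorial := fun z => by
      rw [Complex.exp_eq_exp_ℂ, NormedSpace.exp_eq_tsum_div]
    rw [hexp (-(v * Complex.exp ((θ * σ : ℝ) * Complex.I)) * ((r ^ σ : ℝ) : ℂ))]
    rw [← tsum_mul_left]
    congr 1; ext n
    have e1 : r ^ ((1 - β + σ * n) - 1) = r ^ (-β) * (r ^ σ) ^ n := by
      rw [← Real.rpow_mul_natCast hr'.le, ← Real.rpow_add hr']
      congr 1; ring
    have e2 : Complex.exp ((θ * (1 - β + σ * n) : ℝ) * Complex.I) =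
        Complex.exp ((θ * (1 - β) : ℝ) * Complex.I) * Complex.exp ((θ * σ : ℝ) * Complex.I) ^ n := by
      rw [← Complex.exp_nat_mul, ← Complex.exp_add]
      congr 1; push_cast; ring
    have e3 : rg (n + 1) = ((n.factorial : ℝ))⁻¹ := by
      unfold rg; rw [Real.Gamma_nat_eq_factorial]
    simp only [hFn]
    rw [e1, e2, e3, Real.rpow_one]
    push_cast
    rw [neg_neg]
    have : (-((v:ℂ) * Complex.exp (θ * σ * Complex.I)) * (r ^ σ : ℝ)) ^ n =
      (-(v:ℂ)) ^ n * Complex.exp (θ * σ * Complex.I) ^ n * ((r ^ σ : ℝ) : ℂ) ^ n := by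
      rw [← mul_pow, ← mul_pow]; congr 1; ring
    rw [this]
    ring
  rw [hts] at hS2
  rw [← hS2.tsum_eq, F, ← tsum_mul_left]
  congr 1; ext n
  simp only [hFn]
  rw [integral_const_mul, integral_const_mul, Complex.im_ofReal_mul, hankel hθ0 hθ1 hc (ha n)]
  unfold term
  rw [show 1 - (1 - β + σ * n) = β - σ * n by ring]
  ring

lemma taylor_bound (J : ℕ) : ∃ K : ℝ, 0 ≤ K ∧ ∀ s : ℂ, s.re ≤ 0 →
    ‖Complex.exp s - ∑ m ∈ Finset.range J, s ^ m / m.factorial‖ ≤ K * ‖s‖ ^ J := by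
  refine ⟨Real.exp 1 + (1 + J), by positivity, fun s hs => ?_⟩
  rcases le_total ‖s‖ 1 with h | h
  · have h2 := Complex.norm_exp_sub_sum_le_norm_mul_exp s J
    have h3 : Real.exp ‖s‖ ≤ Real.exp 1 := Real.exp_le_exp.2 h
    have h4 : 0 ≤ ‖s‖ ^ J := by positivity
    calc _ ≤ _ := h2
      _ ≤ ‖s‖ ^ J * Real.exp 1 := by gcongr
      _ ≤ _ := by nlinarith [mul_nonneg h4 (show (0:ℝ) ≤ 1 + J by positivity)]
  · have h4 : 1 ≤ ‖s‖ ^ J := one_le_pow₀ h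
    have h5 : ‖Complex.exp s‖ ≤ 1 := by
      rw [Complex.norm_exp]; exact Real.exp_le_one_iff.2 hs
    have h6 : ‖∑ m ∈ Finset.range J, s ^ m / (m.factorial : ℂ)‖ ≤ J * ‖s‖ ^ J := by
      refine (norm_sum_le _ _).trans ?_
      calc _ ≤ ∑ m ∈ Finset.range J, ‖s‖ ^ J := by
            apply Finset.sum_le_sum
            intro m hm
            rw [norm_div, norm_pow, Complex.norm_natCast]
            have : (1:ℝ) ≤ m.factorial := by exact_mod_cast Nat.one_le_iff_ne_zero.2 (Nat.factorial_ne_zero m)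
            refine (div_le_self (by positivity) this).trans ?_
            exact pow_le_pow_right₀ h (Finset.mem_range.1 hm).le
        _ = _ := by simp
    refine (norm_sub_le _ _).trans ?_
    nlinarith [Real.exp_pos 1]

lemma hI_meas (σ β θ v : ℝ) : Measurable (hI σ β θ v) := by
  unfold hI; fun_prop

lemma hI_norm {σ β θ v r : ℝ} (hr : 0 < r) :
    ‖hI σ β θ v r‖ = r ^ (-β) * Real.exp (-(-Real.cos θ) * r ^ (1:ℝ)) * Real.exp (-(v * Real.cos (θ * σ)) * r ^ σ) := by
  unfold hI
  simp only [norm_mul, Complex.norm_exp_ofReal_mul_I, Complex.norm_real, one_mul]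
  rw [Complex.norm_exp, Complex.norm_exp, Real.norm_of_nonneg (by positivity), Complex.re_mul_ofReal, Complex.re_mul_ofReal,
    Complex.exp_ofReal_mul_I_re, Complex.neg_re, Complex.re_ofReal_mul, Complex.exp_ofReal_mul_I_re]
  simp

lemma hI_int {σ β θ v : ℝ} (hβ : β < 1) (hc : Real.cos θ < 0) (hd : 0 < Real.cos (θ * σ)) (hv : 0 ≤ v) :
    IntegrableOn (hI σ β θ v) (Ioi 0) ∧ ‖∫ r in Ioi (0:ℝ), hI σ β θ v r‖ ≤
      ∫ r in Ioi (0:ℝ), r ^ (-β) * Real.exp (-(-Real.cos θ) * r ^ (1:ℝ)) := by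
  have hb := integrableOn_rpow_mul_exp_neg_mul_rpow (show -1 < -β by linarith) one_pos (show 0 < -Real.cos θ by linarith)
  have hle : ∀ᵐ r ∂(volume.restrict (Ioi (0:ℝ))), ‖hI σ β θ v r‖ ≤ r ^ (-β) * Real.exp (-(-Real.cos θ) * r ^ (1:ℝ)) := by
    filter_upwards [ae_restrict_mem measurableSet_Ioi] with r hr
    have hr' : (0:ℝ) < r := hr
    rw [hI_norm hr']
    apply mul_le_of_le_one_right (by positivity)
    apply Real.exp_le_one_iff.2
    have : 0 ≤ v * Real.cos (θ * σ) * r ^ σ := by positivity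
    linarith
  exact ⟨Integrable.mono' hb (hI_meas _ _ _ _).aestronglyMeasurable hle, norm_integral_le_of_norm_le hb hle⟩

lemma watson {σ : ℝ} (h0 : 0 < σ) {β θ : ℝ} (hβ : β < 1) (hσθ : θ * σ < Real.pi) (hθ0 : 0 < θ)
    (hc : Real.cos θ < 0) (hd : 0 < Real.cos (θ * σ)) (J : ℕ) :
    ∃ K : ℝ, ∀ v, 0 < v → |(∫ r in Ioi (0:ℝ), hI σ β θ v r).im| ≤ K * v ^ (-(J - β + 1) / σ) := by
  obtain ⟨K, hK0, hK⟩ := taylor_bound J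
  refine ⟨K * (Real.cos (θ * σ) ^ (-(J - β + 1) / σ) * (1 / σ) * Real.Gamma ((J - β + 1) / σ)), fun v hv => ?_⟩
  set p : ℂ := v * Complex.exp ((θ * σ : ℝ) * Complex.I) with hp
  have hpre : 0 < p.re := by
    rw [hp, Complex.re_ofReal_mul, Complex.exp_ofReal_mul_I_re]; positivity
  set c : ℕ → ℂ := fun j => ((1 / (j.factorial : ℝ) : ℝ) : ℂ) * Complex.exp ((θ * (j - β + 1) : ℝ) * Complex.I) with hcdef
  set t : ℕ → ℝ → ℂ := fun j r => c j * (((r ^ (j - β) : ℝ) : ℂ) * Complex.exp (-p * ((r ^ σ : ℝ) : ℂ))) with ht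
  have hjβ : ∀ j : ℕ, -1 < (j:ℝ) - β := fun j => by
    have : (0:ℝ) ≤ j := by positivity
    linarith
  have hti : ∀ j, Integrable (t j) (volume.restrict (Ioi 0)) := fun j =>
    (cint_integrable (hjβ j) h0 hpre).const_mul _
  have him : ∀ j, (∫ r in Ioi (0:ℝ), t j r).im = 0 := by
    intro j
    simp only [ht]
    rw [integral_const_mul, cint_eq (hjβ j) h0 hpre, hp, mul_cpow_left hv (Complex.exp_ne_zero _),
      expI_cpow (by have := Real.pi_pos; have : 0 < θ * σ := by positivity
                    linarith) hσθ.le, ← Complex.ofReal_cpow hv.le]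
    simp only [hcdef]
    have e : Complex.exp ((θ * (j - β + 1) : ℝ) * Complex.I) * Complex.exp ((θ * σ * (-(j - β + 1) / σ) : ℝ) * Complex.I) = 1 := by
      rw [← Complex.exp_add, ← Complex.exp_zero]
      congr 1
      rw [← add_mul, ← Complex.ofReal_add]
      rw [show θ * (j - β + 1) + θ * σ * (-(j - β + 1) / σ) = 0 by field_simp; ring]
      simp
    have e2 : ∀ A B C D G : ℂ, D * G = 1 → A * D * (B * G * C) = A * B * C := by
      intro A B C D G h
      calc _ = A * B * C * (D * G) := by ring
        _ = _ := by rw [h, mul_one]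
    rw [e2 _ _ _ _ _ e, ← Complex.ofReal_mul, ← Complex.ofReal_mul, Complex.ofReal_im]
  have hH := (hI_int (σ := σ) hβ hc hd hv.le).1
  have hSi : Integrable (fun r => ∑ j ∈ Finset.range J, t j r) (volume.restrict (Ioi 0)) :=
    integrable_finsetSum _ fun j _ => hti j
  have h1 : (∫ r in Ioi (0:ℝ), hI σ β θ v r).im =
      (∫ r in Ioi (0:ℝ), (hI σ β θ v r - ∑ j ∈ Finset.range J, t j r)).im := by
    rw [integral_sub hH hSi, integral_finsetSum _ fun j _ => hti j, Complex.sub_im, Complex.im_sum,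
      Finset.sum_eq_zero fun j _ => him j, sub_zero]
  rw [h1]
  refine (Complex.abs_im_le_norm _).trans ?_
  have hvd : 0 < v * Real.cos (θ * σ) := by positivity
  have hb := (integrableOn_rpow_mul_exp_neg_mul_rpow (hjβ J) h0 hvd).const_mul K
  have hfin := norm_integral_le_of_norm_le (f := fun r => hI σ β θ v r - ∑ j ∈ Finset.range J, t j r) hb ?_
  · refine hfin.trans (le_of_eq ?_)
    rw [integral_const_mul, integral_rpow_mul_exp_neg_mul_rpow h0 (hjβ J) hvd, Real.mul_rpow hv.le hd.le]
    ring
  · filter_upwards [ae_restrict_mem measurableSet_Ioi] with r hr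
    have hr' : (0:ℝ) < r := hr
    have e : hI σ β θ v r - ∑ j ∈ Finset.range J, t j r =
      Complex.exp ((θ * (1 - β) : ℝ) * Complex.I) * ((r ^ (-β) : ℝ) : ℂ) * Complex.exp (-p * ((r ^ σ : ℝ) : ℂ)) *
       (Complex.exp (Complex.exp (θ * Complex.I) * r) - ∑ m ∈ Finset.range J, (Complex.exp (θ * Complex.I) * r) ^ m / m.factorial) := by
      rw [mul_sub, Finset.mul_sum]
      congr 1
      · unfold hI; ring
      · apply Finset.sum_congr rfl
        intro j _
        simp only [ht, hcdef]
        have e1 : r ^ ((j:ℝ) - β) = r ^ (-β) * r ^ j := by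
          rw [← Real.rpow_natCast, ← Real.rpow_add hr']; congr 1; ring
        have e2 : Complex.exp ((θ * (j - β + 1) : ℝ) * Complex.I) =
          Complex.exp ((θ * (1 - β) : ℝ) * Complex.I) * Complex.exp (θ * Complex.I) ^ j := by
          rw [← Complex.exp_nat_mul, ← Complex.exp_add]
          congr 1; push_cast; ring
        rw [e1, e2, mul_pow]
        push_cast
        ring
    rw [e, norm_mul, norm_mul, norm_mul, Complex.norm_exp_ofReal_mul_I, Complex.norm_real, Real.norm_of_nonneg (by positivity),
      Complex.norm_exp, Complex.re_mul_ofReal, one_mul]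
    have hre : (-p).re = -(v * Real.cos (θ * σ)) := by
      rw [Complex.neg_re, hp, Complex.re_ofReal_mul, Complex.exp_ofReal_mul_I_re]
    rw [hre]
    have hk := hK (Complex.exp (θ * Complex.I) * r) (by
      rw [Complex.re_mul_ofReal, Complex.exp_ofReal_mul_I_re]
      nlinarith)
    rw [norm_mul, Complex.norm_exp_ofReal_mul_I, Complex.norm_real, Real.norm_of_nonneg hr'.le, one_mul] at hk
    have e1 : r ^ ((J:ℝ) - β) = r ^ (-β) * r ^ J := by
      rw [← Real.rpow_natCast, ← Real.rpow_add hr']; congr 1; ring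
    calc _ ≤ r ^ (-β) * Real.exp (-(v * Real.cos (θ * σ)) * r ^ σ) * (K * r ^ J) := by gcongr
      _ = _ := by rw [e1]; ring

lemma decay_base {σ : ℝ} (h0 : 0 < σ) (h1 : σ < 1) (β : ℝ) (hβ : β < 1) : Decay σ β := by
  intro N
  set θ := Real.pi / (1 + σ) with hθ
  have hpi := Real.pi_pos
  have hθ0 : 0 < θ := by positivity
  have hmul : θ * (1 + σ) = Real.pi := by rw [hθ]; field_simp
  have hθ1 : θ < Real.pi := by nlinarith
  have hθ2 : Real.pi / 2 < θ := by nlinarith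
  have hc : Real.cos θ < 0 := Real.cos_neg_of_pi_div_two_lt_of_lt hθ2 (by linarith)
  have hd0 : 0 < θ * σ := by positivity
  have hd1 : θ * σ < Real.pi / 2 := by nlinarith
  have hd : 0 < Real.cos (θ * σ) := Real.cos_pos_of_mem_Ioo ⟨by linarith, hd1⟩
  obtain ⟨J, hJ⟩ := exists_nat_gt (N * σ + β)
  obtain ⟨K, hK⟩ := watson h0 hβ (by linarith) hθ0 hc hd J
  set B := ∫ r in Ioi (0:ℝ), r ^ (-β) * Real.exp (-(-Real.cos θ) * r ^ (1:ℝ))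
  refine ⟨max (B / Real.pi) (K / Real.pi), fun v hv => ?_⟩
  have hrep := F_rep h0 h1 hβ hθ0 hθ1 hc v
  have hF : F σ 1 β v = (∫ r in Ioi (0:ℝ), hI σ β θ v r).im / Real.pi := by
    rw [← hrep]; field_simp
  rw [hF, abs_div, abs_of_pos hpi]
  rcases le_total v 1 with h | h
  · apply le_max_of_le_left
    have hb := (Complex.abs_im_le_norm _).trans (hI_int (σ := σ) hβ hc hd hv).2
    calc _ ≤ 1 * (|(∫ r in Ioi (0:ℝ), hI σ β θ v r).im| / Real.pi) := by
          gcongr; exact pow_le_one₀ hv h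
      _ ≤ _ := by rw [one_mul]; gcongr
  · apply le_max_of_le_right
    have hv0 : 0 < v := by linarith
    have hk := hK v hv0
    have hK0 : 0 ≤ K := by
      have := (abs_nonneg _).trans (hK 1 one_pos)
      simpa using this
    rw [← mul_div_assoc]
    gcongr
    calc v ^ N * |(∫ r in Ioi (0:ℝ), hI σ β θ v r).im| ≤ v ^ N * (K * v ^ (-(J - β + 1) / σ)) := by gcongr
      _ = K * v ^ ((N:ℝ) + -(J - β + 1) / σ) := by rw [Real.rpow_add hv0, Real.rpow_natCast]; ring
      _ ≤ K * 1 := by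
        gcongr
        apply Real.rpow_le_one_of_one_le_of_nonpos h
        rw [neg_div, ← sub_eq_add_neg, sub_nonpos, le_div_iff₀ h0]
        linarith
      _ = K := mul_one K

lemma wallis (n : ℕ) : ∫ u in (0:ℝ)..1, (1 - u ^ 2) ^ n = Real.sqrt Real.pi / 2 * (rg (n + 3 / 2) / rg (n + 1)) := by
  induction n with
  | zero =>
    have h : Real.Gamma (3 / 2) = 1 / 2 * Real.sqrt Real.pi := by
      rw [show (3 / 2 : ℝ) = 1 / 2 + 1 by norm_num, Real.Gamma_add_one (by norm_num), Real.Gamma_one_half_eq]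
    have hp : 0 < Real.sqrt Real.pi := Real.sqrt_pos.2 Real.pi_pos
    simp [rg, h]
    field_simp
  | succ n ih =>
    have hd : ∀ u ∈ uIcc (0:ℝ) 1, HasDerivAt (fun u : ℝ => u * (1 - u ^ 2) ^ (n + 1))
        ((2 * n + 3) * (1 - u ^ 2) ^ (n + 1) - (2 * n + 2) * (1 - u ^ 2) ^ n) u := by
      intro u _
      have h1 : HasDerivAt (fun u : ℝ => 1 - u ^ 2) (-(2 * u)) u := by
        simpa using (hasDerivAt_pow 2 u).const_sub 1
      have h2 := (hasDerivAt_id u).mul (h1.pow (n + 1))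
      refine h2.congr_deriv ?_
      simp only [Nat.add_sub_cancel, id, Pi.pow_apply]
      push_cast
      ring
    have hi := intervalIntegral.integral_eq_sub_of_hasDerivAt hd (by
      apply Continuous.intervalIntegrable; fun_prop)
    rw [intervalIntegral.integral_sub (by apply Continuous.intervalIntegrable; fun_prop)
      (by apply Continuous.intervalIntegrable; fun_prop), intervalIntegral.integral_const_mul,
      intervalIntegral.integral_const_mul, ih] at hi
    simp at hi
    have e1 := rg_rec (n + 3 / 2)
    have e2 := rg_rec (n + 1)
    push_cast
    rw [show (n:ℝ) + 1 + 3 / 2 = n + 3 / 2 + 1 by ring]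
    rw [e1, e2] at hi
    have hn : (0:ℝ) < n + 1 := by positivity
    have hr : rg ((n:ℝ) + 1 + 1) ≠ 0 := inv_ne_zero (Real.Gamma_pos_of_pos (by positivity)).ne'
    have h3 : (2 * (n:ℝ) + 3) ≠ 0 := by positivity
    apply mul_left_cancel₀ h3
    rw [sub_eq_zero.1 hi]
    field_simp

lemma F_half {σ : ℝ} (h0 : 0 < σ) (h1 : σ < 1) (β x : ℝ) :
    Real.sqrt Real.pi / 2 * F σ (3 / 2) β x = ∫ u in (0:ℝ)..1, F σ 1 β (x * (1 - u ^ 2)) := by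
  have hterm : ∀ u n, term σ 1 β (x * (1 - u ^ 2)) n = term σ 1 β x n * (1 - u ^ 2) ^ n := by
    intro u n
    unfold term
    rw [← neg_mul, mul_pow]; ring
  have hS := intervalIntegral.hasSum_integral_of_dominated_convergence (μ := volume) (a := 0) (b := 1)
    (F := fun n u => term σ 1 β (x * (1 - u ^ 2)) n) (f := fun u => F σ 1 β (x * (1 - u ^ 2)))
    (fun n _ => ‖term σ 1 β x n‖) ?_ ?_ ?_ ?_ ?_
  · rw [← hS.tsum_eq, F, ← tsum_mul_left]
    congr 1; ext n
    simp_rw [hterm]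
    rw [intervalIntegral.integral_const_mul, wallis]
    have hr : rg ((n:ℝ) + 1) ≠ 0 := inv_ne_zero (Real.Gamma_pos_of_pos (by positivity)).ne'
    unfold term
    field_simp
  · intro n
    simp_rw [hterm]
    apply Continuous.aestronglyMeasurable; fun_prop
  · intro n
    filter_upwards with u hu
    rw [uIoc_of_le zero_le_one] at hu
    rw [hterm, norm_mul]
    apply mul_le_of_le_one_right (norm_nonneg _)
    rw [norm_pow]
    apply pow_le_one₀ (norm_nonneg _)
    rw [Real.norm_eq_abs, abs_le]
    constructor <;> nlinarith [hu.1, hu.2]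
  · filter_upwards with u _
    exact (summ_term h0 h1 1 β x).norm
  · exact intervalIntegrable_const
  · filter_upwards with u _
    exact (summ_term h0 h1 1 β _).hasSum

def Bdd (σ α β : ℝ) : Prop := ∃ C : ℝ, ∀ x : ℝ, 0 ≤ x → |F σ α β x| ≤ C

lemma bdd_half {σ : ℝ} (h0 : 0 < σ) (h1 : σ < 1) (β : ℝ) (hg : Good σ β) : Bdd σ (3 / 2) β := by
  obtain ⟨C, hC⟩ := decay_all h0 h1 (decay_base h0 h1) β hg 0
  have hp : 0 < Real.sqrt Real.pi / 2 := by
    have := Real.sqrt_pos.2 Real.pi_pos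
    positivity
  refine ⟨C / (Real.sqrt Real.pi / 2), fun x hx => ?_⟩
  rw [le_div_iff₀ hp, mul_comm, ← abs_of_pos hp, ← abs_mul, F_half h0 h1]
  have := intervalIntegral.norm_integral_le_of_norm_le_const (a := (0:ℝ)) (b := 1) (C := C)
    (f := fun u => F σ 1 β (x * (1 - u ^ 2))) (fun u hu => by
      rw [uIoc_of_le zero_le_one] at hu
      have hv : 0 ≤ x * (1 - u ^ 2) := mul_nonneg hx (by nlinarith [hu.1, hu.2])
      simpa using hC _ hv)
  simpa using this

lemma bdd_lower {σ : ℝ} (h0 : 0 < σ) (h1 : σ < 1) (m : ℕ) : ∀ β, Good σ β → Bdd σ (3 / 2 - m) β := by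
  induction m with
  | zero => intro β hg; simpa using bdd_half h0 h1 β hg
  | succ m ih =>
    intro β hg
    obtain ⟨C1, hC1⟩ := ih β hg
    obtain ⟨C2, hC2⟩ := ih (β - 1) hg.sub_one
    set α : ℝ := 3 / 2 - m with hα
    refine ⟨(|σ * (α - 1) + (β - 1)| * C1 + C2) / σ, fun x hx => ?_⟩
    have h := F_rel h0 h1 α β x
    rw [show (3 / 2 - ((m + 1 : ℕ) : ℝ)) = α - 1 by rw [hα]; push_cast; ring]
    have hh : |F σ (α - 1) β x| * σ = |σ * F σ (α - 1) β x| := by rw [abs_mul, abs_of_pos h0, mul_comm]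
    rw [le_div_iff₀ h0, hh, h]
    refine (abs_sub _ _).trans ?_
    rw [abs_mul]
    have := hC1 x hx
    have := hC2 x hx
    gcongr

lemma rg_half (k : ℕ) : rg (1 / 2 - k) = (-1) ^ k * (Real.Gamma (k + 1 / 2) / Real.pi) := by
  have h := rg_refl (show (0:ℝ) < k + 1 / 2 by positivity)
  rw [show (1:ℝ) - (k + 1 / 2) = 1 / 2 - k by ring, show Real.pi * (k + 1 / 2) = k * Real.pi + Real.pi / 2 by ring,
    Real.sin_add_pi_div_two, Real.cos_nat_mul_pi] at h
  rw [h]; ring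

lemma expansion {σ : ℝ} (h0 : 0 < σ) (h1 : σ < 1) (β : ℝ) {x : ℝ} (hx : 0 < x) (M : ℕ) :
    F σ (3 / 2) β x = ∑ k ∈ Finset.range M, Real.Gamma (k + 1 / 2) / Real.pi * (x ^ (k + 1))⁻¹ * rg (β + σ * (k + 1))
      + (-1) ^ M * (x ^ M)⁻¹ * F σ (3 / 2 - M) (β + M * σ) x := by
  induction M with
  | zero => simp
  | succ M ih =>
    rw [ih, Finset.sum_range_succ, add_assoc]
    congr 1
    have h := F_shift h0 h1 (1 / 2 - M) (β + σ * (M + 1)) x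
    rw [show (1 / 2 - (M:ℝ)) + 1 = 3 / 2 - M by ring, show β + σ * (M + 1) - σ = β + M * σ by ring, rg_half] at h
    push_cast
    rw [show 3 / 2 - ((M:ℝ) + 1) = 1 / 2 - M by ring, show β + ((M:ℝ) + 1) * σ = β + σ * (M + 1) by ring, h]
    have hs : ((-1:ℝ) ^ M) * (-1) ^ M = 1 := by rw [← mul_pow]; simp
    have hxM : x ^ M ≠ 0 := by positivity
    generalize Real.Gamma (M + 1 / 2) = G
    generalize rg (β + σ * (M + 1)) = R
    have hpi := Real.pi_pos.ne'
    rcases neg_one_pow_eq_or ℝ M with h' | h'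
    · rw [pow_succ (-1 : ℝ), h', pow_succ]
      field_simp
      ring
    · rw [pow_succ (-1 : ℝ), h', pow_succ]
      field_simp
      ring

lemma struve_real {σ ν t : ℝ} (ht : 0 < t) :
    (Complex.I * (t : ℂ) / 2) ^ (-(ν : ℂ) - 1) * struveL ν (-σ) (Complex.I * (t : ℂ)) =
      ((F σ (3 / 2) (ν + 3 / 2) ((t / 2) ^ 2) : ℝ) : ℂ) := by
  have hne : Complex.I * (t : ℂ) / 2 ≠ 0 := by
    have : (t : ℂ) ≠ 0 := by exact_mod_cast ht.ne'
    simp [this]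
  unfold struveL
  rw [← mul_assoc, ← Complex.cpow_add _ _ hne, show -(ν : ℂ) - 1 + (ν + 1) = 0 by ring, Complex.cpow_zero, one_mul,
    F, Complex.ofReal_tsum]
  congr 1; ext n
  unfold term rg
  have e : (Complex.I * (t : ℂ) / 2) ^ (2 * n) = (((-(t / 2) ^ 2) ^ n : ℝ) : ℂ) := by
    rw [pow_mul]
    push_cast
    congr 1
    rw [div_pow, mul_pow, Complex.I_sq]; ring
  rw [e, div_eq_mul_inv, mul_inv, Complex.ofReal_mul, Complex.ofReal_mul, Complex.ofReal_inv, Complex.ofReal_inv,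
    ← Complex.Gamma_ofReal, ← Complex.Gamma_ofReal, ← mul_assoc]
  congr 4
  · push_cast; ring
  · push_cast; ring

end StruveAux

/-- Complete algebraic asymptotic expansion of `L_ν(it;−σ)` on the imaginary
axis for `0 < σ < 1`:
`(it/2)^{−ν−1} L_ν(it;−σ) ∼ (1/π) Σ_k Γ(k+1/2)(t/2)^{−2k−2}/Γ(ν+3/2+σ(k+1))`
as `t → +∞`, with error after `M` terms of order `t^{−2M−2}`. -/
theorem struveL_neg_sigma_imaginary_axis (σ ν : ℝ) (hσ0 : 0 < σ) (hσ1 : σ < 1)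
    (hks : ∀ (k : ℕ) (m : ℤ), ((k : ℝ) - ν - 1 / 2) / σ ≠ (m : ℝ)) :
    ∀ M : ℕ, ∃ C > (0 : ℝ), ∃ T > (0 : ℝ), ∀ t : ℝ, T ≤ t →
      ‖(Complex.I * (t : ℂ) / 2) ^ (-(ν : ℂ) - 1) *
          struveL ν (-σ) (Complex.I * (t : ℂ)) -
        ((1 / Real.pi * ∑ k ∈ Finset.range M,
          Real.Gamma ((k : ℝ) + 1 / 2) * (t / 2) ^ (-2 * (k : ℝ) - 2) /
            Real.Gamma (ν + 3 / 2 + σ * ((k : ℝ) + 1)) : ℝ) : ℂ)‖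
        ≤ C * t ^ (-2 * (M : ℝ) - 2) := by
  intro M
  have hg : StruveAux.Good σ (ν + 3 / 2) := by
    intro k m e
    apply hks k m
    rw [div_eq_iff hσ0.ne']
    linarith
  obtain ⟨C, hC⟩ := StruveAux.bdd_lower hσ0 hσ1 (M + 1) _ (hg.shift ((M + 1 : ℕ) : ℤ))
  set β := ν + 3 / 2 with hβ
  set c := StruveAux.rg (1 / 2 - M) * StruveAux.rg (β + σ * (M + 1)) with hc
  have hC0 : 0 ≤ C := (abs_nonneg _).trans (hC 0 le_rfl)
  refine ⟨4 ^ (M + 1) * (|c| + C + 1), by positivity, 1, one_pos, fun t ht => ?_⟩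
  have ht0 : 0 < t := by linarith
  have hx : 0 < (t / 2) ^ 2 := by positivity
  rw [StruveAux.struve_real ht0, ← Complex.ofReal_sub, Complex.norm_real, StruveAux.expansion hσ0 hσ1 _ hx M]
  set x := (t / 2) ^ 2 with hxd
  have hpow : ∀ y : ℝ, 0 < y → ∀ k : ℕ, y ^ (-2 * (k : ℝ) - 2) = ((y ^ 2) ^ (k + 1))⁻¹ := by
    intro y hy k
    rw [← pow_mul, ← Real.rpow_natCast, ← Real.rpow_neg hy.le]
    congr 1
    push_cast; ring
  have hsum : 1 / Real.pi * ∑ k ∈ Finset.range M,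
          Real.Gamma ((k : ℝ) + 1 / 2) * (t / 2) ^ (-2 * (k : ℝ) - 2) /
            Real.Gamma (β + σ * ((k : ℝ) + 1)) =
      ∑ k ∈ Finset.range M, Real.Gamma (k + 1 / 2) / Real.pi * (x ^ (k + 1))⁻¹ * StruveAux.rg (β + σ * (k + 1)) := by
    rw [Finset.mul_sum]
    apply Finset.sum_congr rfl
    intro k _
    rw [hpow _ (by positivity), StruveAux.rg]
    ring
  rw [hsum, add_sub_cancel_left, hpow t ht0]
  have h := StruveAux.F_shift hσ0 hσ1 (1 / 2 - M) (β + σ * (M + 1)) x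
  rw [show (1 / 2 - (M:ℝ)) + 1 = 3 / 2 - M by ring, show β + σ * (M + 1) - σ = β + M * σ by ring] at h
  have hC' := hC x hx.le
  have e1 : (3 / 2 - ((M + 1 : ℕ) : ℝ)) = 1 / 2 - M := by push_cast; ring
  have e2 : β + (((M + 1 : ℕ) : ℤ) : ℝ) * σ = β + σ * (M + 1) := by push_cast; ring
  rw [e1, e2] at hC'
  have hF : StruveAux.F σ (3 / 2 - M) (β + M * σ) x = x⁻¹ * (c - StruveAux.F σ (1 / 2 - M) (β + σ * (M + 1)) x) := by
    rw [h, ← hc]; field_simp; ring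
  have hab : |c - StruveAux.F σ (1 / 2 - M) (β + σ * (M + 1)) x| ≤ |c| + C + 1 := by
    refine (abs_sub _ _).trans ?_
    linarith
  rw [hF]
  have hx4 : (x ^ (M + 1))⁻¹ = 4 ^ (M + 1) * ((t ^ 2) ^ (M + 1))⁻¹ := by
    rw [hxd, show (t / 2) ^ 2 = t ^ 2 / 4 by ring, div_pow, inv_div, div_eq_mul_inv]
  calc ‖(-1) ^ M * (x ^ M)⁻¹ * (x⁻¹ * (c - StruveAux.F σ (1 / 2 - M) (β + σ * (M + 1)) x))‖
      = (x ^ (M + 1))⁻¹ * |c - StruveAux.F σ (1 / 2 - M) (β + σ * (M + 1)) x| := by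
        simp only [norm_mul, norm_pow, norm_neg, norm_one, one_pow, one_mul, norm_inv, Real.norm_eq_abs, abs_of_pos hx]
        rw [pow_succ, mul_inv]; ring
    _ ≤ (x ^ (M + 1))⁻¹ * (|c| + C + 1) := by gcongr
    _ = _ := by rw [hx4]; ring
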